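/- arXiv:2008.07526 — 2 statements merged into one kernel-verified Lean document; each statement's English description precedes it below -/
import Mathlib

section
/- There exists an absolute constant c such that for all N, j, m ∈ ℕ with j < N and m ≥ 1, and all x ∈ I_j \ I_{j+1}, ∫_{I_N} (1/m)·( 1 + Σ_{i=0}^{|m|−1} 2^i D_{2^i}(x+s) ) dμ(s) ≤ c · 2^{2j} · 2^{−N} / m. -/
open MeasureTheory Filter
open scoped ENNReal

noncomputable section

namespace WalshKaczmarz

/-- The Walsh group `G`: sequences of elements of `ZMod 2` with coordinatewise
addition modulo 2. -/
abbrev G : Type := ℕ → ZMod 2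

instance : MeasurableSpace (ZMod 2) := ⊤

/-- The normalized Haar (product) measure on `G`, realized as the pushforward of
Lebesgue measure on `[0,1)` under the binary digit expansion map. Each coordinate
is uniformly distributed on `ZMod 2` and coordinates are independent.  -/
def μG : Measure G :=
  Measure.map (fun t : ℝ => fun k : ℕ => ((⌊t * 2 ^ (k + 1)⌋ : ℤ) : ZMod 2))
    (volume.restrict (Set.Ico (0 : ℝ) 1))

/-- The dyadic interval `I_n(x)`. -/
def I (n : ℕ) (x : G) : Set G := {y : G | ∀ k < n, y k = x k}

/-- `e n` : the element of `G` whose `n`-th coordinate is `1` and all others `0`. -/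
def e (n : ℕ) : G := fun k => if k = n then 1 else 0

/-- The `k`-th Rademacher function `r_k(x) = (-1)^{x_k}`. -/
def rademacher (k : ℕ) (x : G) : ℝ := (-1 : ℝ) ^ (x k).val

/-- `|n| = max {j : n_j ≠ 0}`, the order of `n ≥ 1`. -/
def order (n : ℕ) : ℕ := Nat.log 2 n

/-- The Walsh–Paley function `w_n = ∏_k r_k^{n_k}`. -/
def walsh (n : ℕ) (x : G) : ℝ :=
  ∏ k ∈ Finset.range n, (if n.testBit k then rademacher k x else 1)

/-- The Walsh–Kaczmarz function `κ_n`. -/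
def kacz (n : ℕ) (x : G) : ℝ :=
  if n = 0 then 1 else
    rademacher (order n) x *
      (-1 : ℝ) ^ (∑ k ∈ Finset.range (order n),
        (if n.testBit k then (x (order n - 1 - k)).val else 0))

/-- Skvortsov's coordinate transformation `τ_A`. -/
def tau (A : ℕ) (x : G) : G := fun k => if k < A then x (A - 1 - k) else x k

/-- The Walsh–Paley Dirichlet kernel `D_n^w`. -/
def dirW (n : ℕ) (x : G) : ℝ := ∑ k ∈ Finset.range n, walsh k x

/-- The Walsh–Kaczmarz Dirichlet kernel `D_n^κ`. -/
def dirK (n : ℕ) (x : G) : ℝ := ∑ k ∈ Finset.range n, kacz k x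

/-- The Walsh–Paley Fejér kernel `K_n^w = (1/n) ∑_{k=0}^n D_k^w`. -/
def fejW (n : ℕ) (x : G) : ℝ := (1 / (n : ℝ)) * ∑ k ∈ Finset.range (n + 1), dirW k x

/-- The Walsh–Kaczmarz Fejér kernel `K_n^κ = (1/n) ∑_{k=0}^n D_k^κ`. -/
def fejK (n : ℕ) (x : G) : ℝ := (1 / (n : ℝ)) * ∑ k ∈ Finset.range (n + 1), dirK k x

/-- The Walsh–Kaczmarz–Fourier coefficient of an integrable function. -/
def coeffK (f : G → ℝ) (k : ℕ) : ℝ := ∫ x, f x * kacz k x ∂μG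

/-- The `n`-th Walsh–Kaczmarz partial sum `S_n^κ f`. -/
def SK (f : G → ℝ) (n : ℕ) (x : G) : ℝ := ∑ k ∈ Finset.range n, coeffK f k * kacz k x

/-- The `n`-th Walsh–Kaczmarz Fejér mean `σ_n^κ f = (1/n) ∑_{j=0}^n S_j^κ f`. -/
def sigmaK (f : G → ℝ) (n : ℕ) (x : G) : ℝ :=
  (1 / (n : ℝ)) * ∑ j ∈ Finset.range (n + 1), SK f j x

/-- `𝔉_n` : the σ-algebra generated by the dyadic intervals of measure `2^{-n}`. -/
def F (n : ℕ) : MeasurableSpace G := MeasurableSpace.generateFrom {s | ∃ x : G, s = I n x}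

/-- A martingale with respect to the filtration `(𝔉_n)` of dyadic σ-algebras. -/
def IsDyadicMartingale (f : ℕ → G → ℝ) : Prop :=
  (∀ n, Integrable (f n) μG) ∧ (∀ n, StronglyMeasurable[F n] (f n)) ∧
    ∀ n, μG[f (n + 1)|F n] =ᵐ[μG] f n

/-- `‖f‖_{H_p}^p = ∫ (f^*)^p dμ` for a martingale `f`, where `f^* = sup_n |f^{(n)}|`
is the maximal function. -/
def martHpNormP (p : ℝ) (f : ℕ → G → ℝ) : ℝ≥0∞ :=
  ∫⁻ x, (⨆ n, ENNReal.ofReal |f n x|) ^ p ∂μG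

/-- The martingale Hardy norm `‖f‖_{H_p} = ‖f^*‖_{L_p}`. -/
def martHpNorm (p : ℝ) (f : ℕ → G → ℝ) : ℝ≥0∞ := martHpNormP p f ^ (1 / p)

/-- Membership in the martingale Hardy space `H_p(G)`. -/
def MemHp (p : ℝ) (f : ℕ → G → ℝ) : Prop :=
  IsDyadicMartingale f ∧ martHpNormP p f < ∞

/-- The maximal function of an integrable function `g`, i.e. of the martingale
`(S_{2^n} g)`:  `g^*(x) = sup_n (1/μ(I_n(x))) |∫_{I_n(x)} g dμ|`. -/
def funMaximal (g : G → ℝ) (x : G) : ℝ≥0∞ :=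
  ⨆ n : ℕ, ENNReal.ofReal |∫ u in I n x, g u ∂μG| / μG (I n x)

/-- `‖g‖_{H_p}^p` for a function `g`, identified with the martingale `(S_{2^n} g)`. -/
def funHpNormP (p : ℝ) (g : G → ℝ) : ℝ≥0∞ := ∫⁻ x, funMaximal g x ^ p ∂μG

/-- `‖g‖_{L_p}^p = ∫ |g|^p dμ`. -/
def funLpNormP (p : ℝ) (g : G → ℝ) : ℝ≥0∞ := ∫⁻ x, ENNReal.ofReal |g x| ^ p ∂μG

/-- The weak `L_p` quasinorm `‖g‖_{L_{p,∞}} = sup_{λ>0} λ μ({|g|>λ})^{1/p}`. -/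
def weakLpNorm (p : ℝ) (g : G → ℝ) : ℝ≥0∞ :=
  ⨆ (t : ℝ) (_ : 0 < t), ENNReal.ofReal t * μG {x : G | t < |g x|} ^ (1 / p)

/-- The Walsh–Kaczmarz–Fourier coefficient of a martingale:
`f̂(i) = lim_k ∫ f^{(k)} κ_i dμ`. -/
def martCoeffK (f : ℕ → G → ℝ) (i : ℕ) : ℝ :=
  limUnder atTop (fun k => ∫ x, f k x * kacz i x ∂μG)

/-- The `n`-th Walsh–Kaczmarz partial sum of a martingale. -/
def martSK (f : ℕ → G → ℝ) (n : ℕ) (x : G) : ℝ :=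
  ∑ k ∈ Finset.range n, martCoeffK f k * kacz k x

/-- The `n`-th Walsh–Kaczmarz Fejér mean of a martingale. -/
def martSigmaK (f : ℕ → G → ℝ) (n : ℕ) (x : G) : ℝ :=
  (1 / (n : ℝ)) * ∑ j ∈ Finset.range (n + 1), martSK f j x

/-- A `p`-atom supported on the dyadic interval `I_n(x₀)`. -/
def IsPAtomOn (p : ℝ) (n : ℕ) (x₀ : G) (a : G → ℝ) : Prop :=
  Measurable a ∧ (∀ y, y ∉ I n x₀ → a y = 0) ∧ (∫ y in I n x₀, a y ∂μG) = 0 ∧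
    ∀ y, ENNReal.ofReal |a y| ≤ μG (I n x₀) ^ (-(1 / p))

/-- A `p`-atom. -/
def IsPAtom (p : ℝ) (a : G → ℝ) : Prop := ∃ n x₀, IsPAtomOn p n x₀ a

end WalshKaczmarz
namespace WalshKaczmarz

lemma measurableSet_I (n : ℕ) (x : G) : MeasurableSet (I n x) := by
  have h : I n x = ⋂ k ∈ Set.Iio n, (fun y : G => y k) ⁻¹' {x k} := by
    ext y
    simp [I]
  rw [h]
  exact MeasurableSet.biInter (Set.to_countable _) fun k _ =>
    measurable_pi_apply k MeasurableSpace.measurableSet_top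

lemma measurable_binaryDigits :
    Measurable (fun t : ℝ => fun k : ℕ => ((⌊t * 2 ^ (k + 1)⌋ : ℤ) : ZMod 2)) := by
  refine measurable_pi_lambda _ fun k => ?_
  exact (measurable_from_top (f := fun z : ℤ => (z : ZMod 2))).comp
    (Int.measurable_floor.comp (measurable_id.mul_const _))

/-- A real number in `[0,1)` whose first `n` binary digits vanish is less than `2^{-n}`. -/
lemma lt_of_binaryDigits_eq_zero {t : ℝ} (ht0 : 0 ≤ t) (ht1 : t < 1) (n : ℕ)
    (h : ∀ k < n, ((⌊t * 2 ^ (k + 1)⌋ : ℤ) : ZMod 2) = 0) : t * 2 ^ n < 1 := by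
  induction n with
  | zero => simpa using ht1
  | succ n ih =>
    have h1 := ih fun k hk => h k (by omega)
    have h2 := (ZMod.intCast_zmod_eq_zero_iff_dvd _ 2).1 (h n (by omega))
    have h3 : (0 : ℤ) ≤ ⌊t * 2 ^ (n + 1)⌋ := Int.floor_nonneg.2 (by positivity)
    have h4 : ⌊t * 2 ^ (n + 1)⌋ < 2 := by
      rw [Int.floor_lt, pow_succ]
      push_cast
      linarith
    have h5 : ⌊t * 2 ^ (n + 1)⌋ < 1 := by
      push_cast at h2
      omega
    simpa using Int.floor_lt.1 h5

lemma μG_real_I_zero_le (n : ℕ) : μG.real (I n 0) ≤ (2 : ℝ) ^ (-(n : ℤ)) := by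
  refine ENNReal.toReal_le_of_le_ofReal (by positivity) ?_
  rw [μG, Measure.map_apply measurable_binaryDigits (measurableSet_I n 0),
    Measure.restrict_apply (measurable_binaryDigits (measurableSet_I n 0))]
  calc _ ≤ volume (Set.Ico (0 : ℝ) (2 ^ (-(n : ℤ)))) := by
        refine measure_mono ?_
        rintro t ⟨h, ht0, ht1⟩
        refine ⟨ht0, ?_⟩
        have := lt_of_binaryDigits_eq_zero ht0 ht1 n h
        rw [zpow_neg, zpow_natCast, ← one_div, lt_div_iff₀ (by positivity)]
        exact this
    _ = _ := by rw [Real.volume_Ico, sub_zero]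

lemma walsh_eq_prod_range {n M : ℕ} (h : n < 2 ^ M) (x : G) :
    walsh n x = ∏ k ∈ Finset.range M, (if n.testBit k then rademacher k x else 1) := by
  have h_vanish : ∀ {L k : ℕ}, n < 2 ^ L → k ∉ Finset.range L →
      (if n.testBit k then rademacher k x else 1) = 1 := by
    intro L k hL hk
    rw [Finset.mem_range, not_lt] at hk
    simp [Nat.testBit_lt_two_pow (hL.trans_le (Nat.pow_le_pow_right (by norm_num) hk))]
  rw [walsh, Finset.prod_subset (Finset.range_subset_range.2 (le_max_left n M))
      fun k _ hk => h_vanish Nat.lt_two_pow_self hk,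
    Finset.prod_subset (Finset.range_subset_range.2 (le_max_right n M))
      fun k _ hk => h_vanish h hk]

lemma walsh_two_pow_add {i k : ℕ} (hk : k < 2 ^ i) (x : G) :
    walsh (2 ^ i + k) x = rademacher i x * walsh k x := by
  rw [walsh_eq_prod_range (M := i + 1) (by rw [pow_succ]; omega), walsh_eq_prod_range hk,
    Finset.prod_range_succ, Nat.testBit_two_pow_add_eq, Nat.testBit_lt_two_pow hk, mul_comm]
  congr 1
  refine Finset.prod_congr rfl fun l hl => ?_
  rw [Nat.testBit_two_pow_add_gt (Finset.mem_range.1 hl)]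

lemma dirW_two_pow (i : ℕ) (x : G) :
    dirW (2 ^ i) x = ∏ k ∈ Finset.range i, (1 + rademacher k x) := by
  induction i with
  | zero => simp [dirW, walsh]
  | succ i ih =>
    rw [Finset.prod_range_succ, ← ih, pow_succ, mul_two, dirW, Finset.sum_range_add,
      Finset.sum_congr rfl fun k hk => walsh_two_pow_add (Finset.mem_range.1 hk) x,
      ← Finset.mul_sum, ← dirW]
    ring

lemma dirW_two_pow_of_mem {i : ℕ} {x : G} (hx : x ∈ I i 0) : dirW (2 ^ i) x = 2 ^ i := by
  rw [dirW_two_pow, Finset.prod_congr rfl (g := fun _ => (2 : ℝ))]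
  · simp
  · intro k hk
    rw [rademacher, hx k (Finset.mem_range.1 hk)]
    norm_num

lemma dirW_two_pow_of_notMem {i : ℕ} {x : G} (hx : x ∉ I i 0) : dirW (2 ^ i) x = 0 := by
  simp only [I, Set.mem_ofPred_eq, not_forall] at hx
  obtain ⟨k, hk, hne⟩ := hx
  rw [dirW_two_pow]
  refine Finset.prod_eq_zero (Finset.mem_range.2 hk) ?_
  have h1 : x k = 1 := by
    rw [Pi.zero_apply] at hne
    generalize x k = a at hne
    revert a
    decide
  simp [rademacher, h1, ZMod.val_one]

lemma add_mem_I_zero_iff {n N : ℕ} (h : n ≤ N) {x s : G} (hs : s ∈ I N 0) :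
    x + s ∈ I n 0 ↔ x ∈ I n 0 := by
  refine forall₂_congr fun k hk => ?_
  simp [hs k (by omega)]

lemma mem_I_zero_mono {m n : ℕ} (h : m ≤ n) {x : G} (hx : x ∈ I n 0) : x ∈ I m 0 :=
  fun k hk => hx k (by omega)

lemma dirW_two_pow_of_mem_diff {j : ℕ} {x : G} (hx : x ∈ I j 0 \ I (j + 1) 0) (i : ℕ) :
    dirW (2 ^ i) x = if i ≤ j then 2 ^ i else 0 := by
  split_ifs with h
  · exact dirW_two_pow_of_mem (mem_I_zero_mono h hx.1)
  · exact dirW_two_pow_of_notMem fun h' => hx.2 (mem_I_zero_mono (by omega) h')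

lemma sum_four_pow_le (n j : ℕ) :
    ∑ i ∈ Finset.range n, (2 : ℝ) ^ i * (if i ≤ j then 2 ^ i else 0) ≤ 2 * 2 ^ (2 * j) := by
  calc _ = ∑ i ∈ Finset.range n with i ≤ j, (4 : ℝ) ^ i := by
        rw [Finset.sum_filter]
        refine Finset.sum_congr rfl fun i _ => ?_
        split_ifs
        · rw [← mul_pow]; norm_num
        · simp
    _ ≤ ∑ i ∈ Finset.range (j + 1), (4 : ℝ) ^ i := by
        refine Finset.sum_le_sum_of_subset_of_nonneg (fun i hi => ?_) fun _ _ _ => by positivity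
        simp only [Finset.mem_filter, Finset.mem_range] at hi ⊢
        omega
    _ ≤ 2 * 2 ^ (2 * j) := by
        rw [geom_sum_eq (by norm_num), pow_mul, pow_succ]
        norm_num
        have : (0 : ℝ) < 4 ^ j := by positivity
        linarith

/-- There is an absolute constant `c` such that for `j < N`, `m ≥ 1` and
`x ∈ I_j \ I_{j+1}`,
`∫_{I_N} (1/m)(1 + ∑_{i<|m|} 2^i D_{2^i}(x+s)) dμ(s) ≤ c 2^{2j} 2^{-N} / m`. -/
theorem L1_term_integral_bound :
    ∃ c : ℝ, ∀ (N j m : ℕ) (x : G), j < N → 1 ≤ m →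
      x ∈ I j 0 \ I (j + 1) 0 →
      (∫ s in I N 0, (1 / (m : ℝ)) *
          (1 + ∑ i ∈ Finset.range (order m), (2 : ℝ) ^ i * dirW (2 ^ i) (x + s)) ∂μG) ≤
        c * 2 ^ (2 * j) * (2 : ℝ) ^ (-(N : ℤ)) / m := by
  refine ⟨3, fun N j m x hjN _ hx => ?_⟩
  rw [setIntegral_congr_fun (g := fun _ => (1 / (m : ℝ)) * (1 + ∑ i ∈ Finset.range (order m),
    (2 : ℝ) ^ i * (if i ≤ j then 2 ^ i else 0))) (measurableSet_I N 0), setIntegral_const,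
    smul_eq_mul]
  · have h1 : (1 : ℝ) + ∑ i ∈ Finset.range (order m),
        (2 : ℝ) ^ i * (if i ≤ j then 2 ^ i else 0) ≤ 3 * 2 ^ (2 * j) := by
      have := sum_four_pow_le (order m) j
      have : (1 : ℝ) ≤ 2 ^ (2 * j) := one_le_pow₀ (by norm_num)
      linarith
    calc _ ≤ (2 : ℝ) ^ (-(N : ℤ)) * ((1 / (m : ℝ)) * (3 * 2 ^ (2 * j))) := by
          gcongr
          exact μG_real_I_zero_le N
      _ = _ := by ring
  · intro s hs
    have hxs : x + s ∈ I j 0 \ I (j + 1) 0 :=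
      ⟨(add_mem_I_zero_iff hjN.le hs).2 hx.1, fun h => hx.2 ((add_mem_I_zero_iff hjN hs).1 h)⟩
    simp only [dirW_two_pow_of_mem_diff hxs]

end WalshKaczmarz
end
end

section
/- Let 0 < p ≤ 1/2 and let [p+1/2] denote the integer part of p+1/2 (so it is 0 for p < 1/2 and 1 for p = 1/2). There is a constant c_p such that for every N ∈ ℕ, every p-atom a supported on I_N with ‖a‖_∞ ≤ 2^{N/p}, and every n > 2^N, (1/(log n)^{[p+1/2]}) · Σ_{m=2^N}^{n} ( ∫_{I_N} |σ_m^κ a|^p dμ ) / m^{2−2p} ≤ c_p. -/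
open MeasureTheory Filter
open scoped ENNReal

noncomputable section

namespace WalshKaczmarz

/-- The binary digit expansion map defining `μG`. -/
def digits (t : ℝ) : G := fun k => ((⌊t * 2 ^ (k + 1)⌋ : ℤ) : ZMod 2)

lemma measurable_digits : Measurable digits := by
  refine measurable_pi_lambda _ fun k => ?_
  have hcast : Measurable (fun z : ℤ => (z : ZMod 2)) := measurable_from_top
  exact hcast.comp (Int.measurable_floor.comp (measurable_id.mul_const _))

lemma μG_eq_map : μG = Measure.map digits (volume.restrict (Set.Ico (0 : ℝ) 1)) := rfl

instance : IsProbabilityMeasure μG := by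
  have : IsProbabilityMeasure (volume.restrict (Set.Ico (0 : ℝ) 1)) := ⟨by simp⟩
  rw [μG_eq_map]
  exact Measure.isProbabilityMeasure_map measurable_digits.aemeasurable

lemma measurable_rademacher (k : ℕ) : Measurable (rademacher k) := by
  have h : Measurable (fun z : ZMod 2 => (-1 : ℝ) ^ z.val) := measurable_from_top
  exact h.comp (measurable_pi_apply k)

lemma rademacher_mul_self (k : ℕ) (x : G) : rademacher k x * rademacher k x = 1 := by
  rw [rademacher, ← mul_pow]; norm_num

/-- The character `∏_{k ∈ s} r_k` of the Walsh group. -/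
def character (s : Finset ℕ) (x : G) : ℝ := ∏ k ∈ s, rademacher k x

lemma measurable_character (s : Finset ℕ) : Measurable (character s) :=
  Finset.measurable_fun_prod _ fun k _ => measurable_rademacher k

lemma character_mul_self (s : Finset ℕ) (x : G) : character s x * character s x = 1 := by
  rw [character, ← Finset.prod_mul_distrib]
  exact Finset.prod_eq_one fun k _ => rademacher_mul_self k x

lemma character_mul (s t : Finset ℕ) (x : G) :
    character s x * character t x = character (symmDiff s t) x := by
  have hs : character s x = character (s \ t) x * character (s ∩ t) x := by
    rw [mul_comm]; exact (Finset.prod_inter_mul_prod_sdiff s t _).symm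
  have ht : character t x = character (t \ s) x * character (s ∩ t) x := by
    rw [mul_comm, Finset.inter_comm]; exact (Finset.prod_inter_mul_prod_sdiff t s _).symm
  have hd : character (symmDiff s t) x = character (s \ t) x * character (t \ s) x :=
    Finset.prod_union disjoint_sdiff_sdiff
  rw [hs, ht, hd]
  linear_combination
    character (s \ t) x * character (t \ s) x * character_mul_self (s ∩ t) x

lemma rademacher_digits_add_of_eq {t c : ℝ} {k : ℕ} {z : ℤ} (hz : c * 2 ^ (k + 1) = z) :
    rademacher k (digits (t + c)) = (-1) ^ ((z : ZMod 2)).val * rademacher k (digits t) := by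
  have h : digits (t + c) k = digits t k + (z : ZMod 2) := by
    simp only [digits, add_mul, hz, Int.floor_add_intCast, Int.cast_add]
  simp only [rademacher, h]
  generalize digits t k = u
  generalize (z : ZMod 2) = v
  rw [ZMod.val_add, mul_comm, ← pow_add, neg_one_pow_eq_pow_mod_two (u.val + v.val)]

lemma integral_character {s : Finset ℕ} (hs : s.Nonempty) : ∫ x, character s x ∂μG = 0 := by
  set j := s.min' hs
  set h : ℝ → ℝ := fun t => character s (digits t) with hh
  have hper : Function.Periodic h 1 := fun t => by
    refine Finset.prod_congr rfl fun k _ => ?_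
    rw [rademacher_digits_add_of_eq (z := 2 ^ (k + 1)) (by push_cast; ring)]
    have : (((2 : ℤ) ^ (k + 1) : ℤ) : ZMod 2) = 0 := by
      push_cast; rw [show (2 : ZMod 2) = 0 from rfl]; simp
    simp [this]
  have hanti : ∀ t, h (t + (2 ^ (j + 1))⁻¹) = -h t := fun t => by
    have hjs : j ∈ s := s.min'_mem hs
    simp only [hh, character]
    rw [← Finset.mul_prod_erase s _ hjs, ← Finset.mul_prod_erase s _ hjs,
      rademacher_digits_add_of_eq (z := 1) (by push_cast; field_simp), ← neg_mul]
    congr 1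
    · simp [ZMod.val_one]
    · refine Finset.prod_congr rfl fun k hk => ?_
      have hjk : j < k := lt_of_le_of_ne (s.min'_le k (Finset.mem_of_mem_erase hk))
        (Finset.ne_of_mem_erase hk).symm
      obtain ⟨d, rfl⟩ := Nat.exists_eq_add_of_lt hjk
      rw [rademacher_digits_add_of_eq (z := 2 ^ (d + 1))
        (by push_cast; field_simp; ring)]
      have : (((2 : ℤ) ^ (d + 1) : ℤ) : ZMod 2) = 0 := by
        push_cast; rw [show (2 : ZMod 2) = 0 from rfl]; simp
      simp [this]
  have hshift : ∫ t in (0 : ℝ)..1, h (t + (2 ^ (j + 1))⁻¹) = ∫ t in (0 : ℝ)..1, h t := by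
    rw [intervalIntegral.integral_comp_add_right]
    simpa [add_comm] using hper.intervalIntegral_add_eq ((2 ^ (j + 1))⁻¹) 0
  simp only [hanti, intervalIntegral.integral_neg] at hshift
  rw [μG_eq_map, integral_map measurable_digits.aemeasurable
    (measurable_character s).aestronglyMeasurable, integral_Ico_eq_integral_Ioc,
    ← intervalIntegral.integral_of_le zero_le_one]
  change ∫ t in (0 : ℝ)..1, h t = 0
  linarith

lemma integral_character_mul_character (s t : Finset ℕ) :
    ∫ x, character s x * character t x ∂μG = if s = t then 1 else 0 := by
  split_ifs with h
  · subst h; simp [character_mul_self]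
  · simp only [character_mul]
    exact integral_character (Finset.nonempty_iff_ne_empty.2 fun h0 => h (symmDiff_eq_bot.1 h0))

/-- The set of coordinates on which `κ_n` depends. -/
def kaczSupport (n : ℕ) : Finset ℕ :=
  if n = 0 then ∅ else
    insert (order n) ((Finset.range (order n)).filter fun k => n.testBit (order n - 1 - k))

lemma kacz_eq_character (n : ℕ) : kacz n = character (kaczSupport n) := by
  funext x
  by_cases hn : n = 0
  · simp [kacz, kaczSupport, character, hn]
  · rw [kacz, kaczSupport, if_neg hn, if_neg hn, character, Finset.prod_insert (by simp),
      Finset.prod_filter, ← Finset.prod_pow_eq_pow_sum, ← Finset.prod_range_reflect]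
    congr 1
    refine Finset.prod_congr rfl fun k hk => ?_
    rw [Finset.mem_range] at hk
    have : order n - 1 - (order n - 1 - k) = k := by omega
    rw [this]
    split_ifs <;> simp [rademacher]

lemma le_order_of_mem_kaczSupport {n k : ℕ} (h : k ∈ kaczSupport n) : k ≤ order n := by
  unfold kaczSupport at h
  split_ifs at h with hn
  · simp at h
  · rcases Finset.mem_insert.1 h with h | h
    · exact h.le
    · exact (Finset.mem_range.1 (Finset.mem_filter.1 h).1).le

lemma order_mem_kaczSupport {n : ℕ} (hn : n ≠ 0) : order n ∈ kaczSupport n := by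
  simp [kaczSupport, hn]

lemma testBit_iff_mem_kaczSupport {n k : ℕ} (hn : n ≠ 0) (hk : k < order n) :
    n.testBit k ↔ order n - 1 - k ∈ kaczSupport n := by
  have h1 : order n - 1 - k ≠ order n := by omega
  have h2 : order n - 1 - k < order n := by omega
  have h3 : order n - 1 - (order n - 1 - k) = k := by omega
  simp [kaczSupport, hn, h1, h2, h3]

lemma kaczSupport_injective : Function.Injective kaczSupport := by
  intro n m h
  by_cases hn : n = 0
  · by_contra hne
    have := order_mem_kaczSupport (n := m) (fun hm => hne (hn.trans hm.symm))
    rw [← h, hn] at this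
    simp [kaczSupport] at this
  by_cases hm : m = 0
  · have := order_mem_kaczSupport hn
    rw [h, hm] at this
    simp [kaczSupport] at this
  have hord : order n = order m :=
    le_antisymm (le_order_of_mem_kaczSupport (h ▸ order_mem_kaczSupport hn))
      (le_order_of_mem_kaczSupport (h ▸ order_mem_kaczSupport hm))
  refine Nat.eq_of_testBit_eq fun k => ?_
  rcases lt_trichotomy k (order n) with hk | hk | hk
  · rw [Bool.eq_iff_iff, testBit_iff_mem_kaczSupport hn hk,
      testBit_iff_mem_kaczSupport hm (hord ▸ hk), h, hord]
  · have key : ∀ {l : ℕ}, l ≠ 0 → l.testBit (order l) = true := fun {l} hl => by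
      rw [order, ← Nat.log2_eq_log_two]
      exact Nat.testBit_log2 hl
    rw [hk, key hn, hord, key hm]
  · have key : ∀ {l : ℕ}, order l < k → l.testBit k = false := fun {l} hl =>
      Nat.testBit_lt_two_pow (Nat.lt_pow_of_log_lt one_lt_two hl)
    rw [key hk, key (hord ▸ hk)]

lemma integral_kacz_mul_kacz (n m : ℕ) :
    ∫ x, kacz n x * kacz m x ∂μG = if n = m then 1 else 0 := by
  simp only [kacz_eq_character, integral_character_mul_character, kaczSupport_injective.eq_iff]

lemma measurable_kacz (n : ℕ) : Measurable (kacz n) := by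
  rw [kacz_eq_character]; exact measurable_character _

lemma memLp_kacz (n : ℕ) : MemLp (kacz n) 2 μG := by
  refine MemLp.of_bound (measurable_kacz n).aestronglyMeasurable 1 (ae_of_all _ fun x => ?_)
  rw [kacz_eq_character, Real.norm_eq_abs, ← sq_le_one_iff_abs_le_one, sq, character_mul_self]

lemma memLp_SK (f : G → ℝ) (n : ℕ) : MemLp (SK f n) 2 μG :=
  memLp_finsetSum _ fun k _ => (memLp_kacz k).const_mul _

lemma measurable_sigmaK (f : G → ℝ) (n : ℕ) : Measurable (sigmaK f n) :=
  (Finset.measurable_fun_sum _ fun _ _ => Finset.measurable_fun_sum _ fun k _ =>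
    (measurable_kacz k).const_mul _).const_mul _

/-- Bessel's inequality for the Walsh–Kaczmarz system. -/
lemma integral_SK_sq_le {f : G → ℝ} (hf : MemLp f 2 μG) (n : ℕ) :
    ∫ x, SK f n x ^ 2 ∂μG ≤ ∫ x, f x ^ 2 ∂μG := by
  have hmul : ∀ {g : G → ℝ}, MemLp g 2 μG →
      ∫ x, g x * SK f n x ∂μG = ∑ k ∈ Finset.range n, coeffK f k * coeffK g k := fun {g} hg => by
    simp only [SK, Finset.mul_sum]
    rw [integral_finsetSum _ fun k _ => ?_]
    · refine Finset.sum_congr rfl fun k _ => ?_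
      rw [coeffK, coeffK, ← integral_const_mul]
      simp only [mul_left_comm]
    · exact hg.integrable_mul ((memLp_kacz k).const_mul _)
  have hcoeff : ∀ k ∈ Finset.range n, coeffK (SK f n) k = coeffK f k := fun k hk => by
    conv_lhs => rw [coeffK]
    simp only [SK, Finset.sum_mul]
    rw [integral_finsetSum _ fun l _ => ?_]
    · simp only [mul_assoc, integral_const_mul, integral_kacz_mul_kacz]
      simp [Finset.mem_range.1 hk]
    · exact ((memLp_kacz l).const_mul _).integrable_mul (memLp_kacz k)
  have hSS : ∫ x, SK f n x ^ 2 ∂μG = ∫ x, f x * SK f n x ∂μG := by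
    simp only [sq]
    rw [hmul (memLp_SK f n), hmul hf]
    exact Finset.sum_congr rfl fun k hk => by rw [hcoeff k hk]
  have hnonneg : 0 ≤ ∫ x, (f x - SK f n x) ^ 2 ∂μG := integral_nonneg fun x => sq_nonneg _
  have hexp : ∫ x, (f x - SK f n x) ^ 2 ∂μG
      = ∫ x, f x ^ 2 ∂μG - 2 * ∫ x, f x * SK f n x ∂μG + ∫ x, SK f n x ^ 2 ∂μG := by
    have hi : Integrable (fun x => 2 * (f x * SK f n x)) μG :=
      (hf.integrable_mul (memLp_SK f n)).const_mul 2
    have hi' : Integrable (fun x => f x ^ 2 - 2 * (f x * SK f n x)) μG := hf.integrable_sq.sub hi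
    rw [← integral_const_mul, ← integral_sub hf.integrable_sq hi,
      ← integral_add hi' (memLp_SK f n).integrable_sq]
    congr 1
    funext x
    ring
  linarith

lemma sigmaK_sq_le (f : G → ℝ) (n : ℕ) (x : G) :
    sigmaK f n x ^ 2 ≤ (1 / (n : ℝ)) * ∑ j ∈ Finset.range n, SK f (j + 1) x ^ 2 := by
  have h := sq_sum_le_card_mul_sum_sq (s := Finset.range n) (f := fun j => SK f (j + 1) x)
  rw [Finset.card_range] at h
  have h0 : SK f 0 x = 0 := by simp [SK]
  rw [sigmaK, Finset.sum_range_succ', h0, add_zero, mul_pow]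
  refine (mul_le_mul_of_nonneg_left h (sq_nonneg _)).trans_eq ?_
  rcases eq_or_ne n 0 with rfl | hn
  · simp
  · field_simp

lemma integral_sigmaK_sq_le {f : G → ℝ} (hf : MemLp f 2 μG) (n : ℕ) :
    ∫ x, sigmaK f n x ^ 2 ∂μG ≤ ∫ x, f x ^ 2 ∂μG := by
  have hint : ∀ j ∈ Finset.range n, Integrable (fun x => SK f (j + 1) x ^ 2) μG :=
    fun j _ => (memLp_SK f (j + 1)).integrable_sq
  calc ∫ x, sigmaK f n x ^ 2 ∂μG
      ≤ ∫ x, (1 / (n : ℝ)) * ∑ j ∈ Finset.range n, SK f (j + 1) x ^ 2 ∂μG :=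
        integral_mono_of_nonneg (ae_of_all _ fun x => sq_nonneg _)
          ((integrable_finsetSum _ hint).const_mul _) (ae_of_all _ (sigmaK_sq_le f n))
    _ = (1 / (n : ℝ)) * ∑ j ∈ Finset.range n, ∫ x, SK f (j + 1) x ^ 2 ∂μG := by
        rw [integral_const_mul, integral_finsetSum _ hint]
    _ ≤ (1 / (n : ℝ)) * ∑ j ∈ Finset.range n, ∫ x, f x ^ 2 ∂μG := by
        exact mul_le_mul_of_nonneg_left
          (Finset.sum_le_sum fun j _ => integral_SK_sq_le hf (j + 1)) (by positivity)
    _ ≤ ∫ x, f x ^ 2 ∂μG := by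
        rw [Finset.sum_const, Finset.card_range, nsmul_eq_mul, ← mul_assoc]
        refine mul_le_of_le_one_left (integral_nonneg fun x => sq_nonneg _) ?_
        rw [one_div]
        exact inv_mul_le_one

lemma memLp_sigmaK (f : G → ℝ) (n : ℕ) : MemLp (sigmaK f n) 2 μG :=
  (memLp_finsetSum _ fun j _ => memLp_SK f j).const_mul _

lemma lintegral_sigmaK_sq_le {f : G → ℝ} (hf : MemLp f 2 μG) (n : ℕ) :
    ∫⁻ x, ENNReal.ofReal |sigmaK f n x| ^ (2 : ℝ) ∂μG
      ≤ ∫⁻ x, ENNReal.ofReal |f x| ^ (2 : ℝ) ∂μG := by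
  have hsq : ∀ {g : G → ℝ}, MemLp g 2 μG →
      ∫⁻ x, ENNReal.ofReal |g x| ^ (2 : ℝ) ∂μG = ENNReal.ofReal (∫ x, g x ^ 2 ∂μG) :=
    fun {g} hg => by
      rw [ofReal_integral_eq_lintegral_ofReal hg.integrable_sq (ae_of_all _ fun x => sq_nonneg _)]
      refine lintegral_congr fun x => ?_
      rw [ENNReal.rpow_two, ← ENNReal.ofReal_pow (abs_nonneg _), sq_abs]
  rw [hsq (memLp_sigmaK f n), hsq hf]
  exact ENNReal.ofReal_le_ofReal (integral_sigmaK_sq_le hf n)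

lemma setLIntegral_rpow_le {p : ℝ} (hp0 : 0 < p) (hp : p ≤ 2) {g : G → ℝ} (hg : Measurable g)
    (s : Set G) :
    ∫⁻ x in s, ENNReal.ofReal |g x| ^ p ∂μG
      ≤ (∫⁻ x in s, ENNReal.ofReal |g x| ^ (2 : ℝ) ∂μG) ^ (p / 2) * μG s ^ (1 - p / 2) := by
  have h := eLpNorm'_le_eLpNorm'_mul_rpow_measure_univ (μ := μG.restrict s) hp0 hp
    hg.aestronglyMeasurable
  have h' := ENNReal.rpow_le_rpow h hp0.le
  rw [ENNReal.mul_rpow_of_nonneg _ _ hp0.le, Measure.restrict_apply_univ, ← ENNReal.rpow_mul,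
    eLpNorm', eLpNorm', ← ENNReal.rpow_mul, ← ENNReal.rpow_mul] at h'
  simp only [Real.enorm_eq_ofReal_abs] at h'
  convert h' using 2
  · rw [one_div, inv_mul_cancel₀ hp0.ne', ENNReal.rpow_one]
  · congr 1; ring
  · congr 1; field_simp

/-- On the support of a `p`-atom the Fejér means have `L_p` quasinorm at most `1`. -/
lemma setLIntegral_sigmaK_atom_le {p : ℝ} (hp0 : 0 < p) (hp : p ≤ 2) {N : ℕ} {x₀ : G} {a : G → ℝ}
    (ha : IsPAtomOn p N x₀ a) (m : ℕ) :
    ∫⁻ x in I N x₀, ENNReal.ofReal |sigmaK a m x| ^ p ∂μG ≤ 1 := by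
  obtain ⟨hmeas, hsupp, -, hbound⟩ := ha
  set V := μG (I N x₀)
  rcases eq_or_ne V 0 with hV0 | hV0
  · rw [setLIntegral_measure_zero _ _ hV0]; exact zero_le_one
  have hVtop : V ≠ ∞ := measure_ne_top _ _
  have hMtop : V ^ (-(1 / p)) ≠ ∞ := ENNReal.rpow_ne_top_of_ne_zero hV0 hVtop
  have haL : MemLp a 2 μG := by
    refine MemLp.of_bound hmeas.aestronglyMeasurable (V ^ (-(1 / p))).toReal
      (ae_of_all _ fun x => ?_)
    rw [Real.norm_eq_abs]
    exact (ENNReal.ofReal_le_iff_le_toReal hMtop).1 (hbound x)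
  have ha2 : ∫⁻ x, ENNReal.ofReal |a x| ^ (2 : ℝ) ∂μG ≤ (V ^ (-(1 / p))) ^ (2 : ℝ) * V := by
    refine (lintegral_mono fun x => ?_).trans (lintegral_indicator_const_le (I N x₀) _)
    by_cases hx : x ∈ I N x₀
    · rw [Set.indicator_of_mem hx]
      exact ENNReal.rpow_le_rpow (hbound x) zero_le_two
    · simp [hsupp x hx]
  calc ∫⁻ x in I N x₀, ENNReal.ofReal |sigmaK a m x| ^ p ∂μG
      ≤ (∫⁻ x in I N x₀, ENNReal.ofReal |sigmaK a m x| ^ (2 : ℝ) ∂μG) ^ (p / 2)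
          * V ^ (1 - p / 2) := setLIntegral_rpow_le hp0 hp (measurable_sigmaK a m) _
    _ ≤ ((V ^ (-(1 / p))) ^ (2 : ℝ) * V) ^ (p / 2) * V ^ (1 - p / 2) := by
        gcongr
        exact (setLIntegral_le_lintegral _ _).trans ((lintegral_sigmaK_sq_le haL m).trans ha2)
    _ = 1 := by
        rw [← ENNReal.rpow_mul]
        nth_rewrite 2 [← ENNReal.rpow_one V]
        rw [← ENNReal.rpow_add _ _ hV0 hVtop, ← ENNReal.rpow_mul,
          ← ENNReal.rpow_add _ _ hV0 hVtop]
        convert ENNReal.rpow_zero using 2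
        field_simp
        ring

lemma natCast_rpow_inv_eq_ofReal {m : ℕ} (hm : m ≠ 0) (s : ℝ) :
    ((m : ℝ≥0∞) ^ s)⁻¹ = ENNReal.ofReal (1 / (m : ℝ) ^ s) := by
  have hm' : (0 : ℝ) < m := by positivity
  rw [one_div, ENNReal.ofReal_inv_of_pos (Real.rpow_pos_of_pos hm' s),
    ← ENNReal.ofReal_rpow_of_pos hm', ENNReal.ofReal_natCast]

lemma sum_Icc_rpow_inv_le_tsum {s : ℝ} (hs : 1 < s) {k : ℕ} (hk : k ≠ 0) (n : ℕ) :
    ∑ m ∈ Finset.Icc k n, ((m : ℝ≥0∞) ^ s)⁻¹ ≤ ENNReal.ofReal (∑' m : ℕ, 1 / (m : ℝ) ^ s) := by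
  have hnonneg : ∀ m : ℕ, 0 ≤ 1 / (m : ℝ) ^ s := fun m => by positivity
  rw [Finset.sum_congr rfl fun m hm => natCast_rpow_inv_eq_ofReal
    (by have := (Finset.mem_Icc.1 hm).1; omega) s, ← ENNReal.ofReal_sum_of_nonneg
    fun m _ => hnonneg m]
  exact ENNReal.ofReal_le_ofReal ((Real.summable_one_div_nat_rpow.2 hs).sum_le_tsum _
    fun m _ => hnonneg m)

lemma sum_Icc_inv_le_one_add_log {k : ℕ} (hk : k ≠ 0) (n : ℕ) :
    ∑ m ∈ Finset.Icc k n, ((m : ℝ≥0∞) ^ (1 : ℝ))⁻¹ ≤ ENNReal.ofReal (1 + Real.log n) := by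
  rw [Finset.sum_congr rfl fun m hm => natCast_rpow_inv_eq_ofReal
    (by have := (Finset.mem_Icc.1 hm).1; omega) 1, ← ENNReal.ofReal_sum_of_nonneg
    fun m _ => by positivity]
  refine ENNReal.ofReal_le_ofReal (le_trans ?_ (harmonic_le_one_add_log n))
  rw [harmonic_eq_sum_Icc]
  push_cast
  simp only [Real.rpow_one, one_div]
  exact Finset.sum_le_sum_of_subset_of_nonneg
    (Finset.Icc_subset_Icc_left (Nat.one_le_iff_ne_zero.2 hk)) fun m _ _ => by positivity

/-- For `0 < p ≤ 1/2`, with `[p+1/2] = ⌊p+1/2⌋` (`0` for `p < 1/2`, `1` for `p = 1/2`),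
there is a constant `c_p` such that for every `p`-atom `a` supported on `I_N`
(so `‖a‖_∞ ≤ 2^{N/p}`) and every `n > 2^N`,
`(1/(log n)^{[p+1/2]}) ∑_{m=2^N}^n (∫_{I_N} |σ_m^κ a|^p dμ)/m^{2-2p} ≤ c_p`. -/
theorem atom_estimate_inside (p : ℝ) (hp0 : 0 < p) (hp : p ≤ 1/2) :
    ∃ c : ℝ, ∀ (N : ℕ) (a : G → ℝ), IsPAtomOn p N 0 a → ∀ n : ℕ, 2 ^ N < n →
      (1 / ENNReal.ofReal (Real.log n) ^ (⌊p + 1/2⌋₊ : ℕ)) *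
          ∑ m ∈ Finset.Icc (2 ^ N) n,
            (∫⁻ x in I N 0, ENNReal.ofReal |sigmaK a m x| ^ p ∂μG)
              / (m : ℝ≥0∞) ^ (2 - 2 * p) ≤
        ENNReal.ofReal c := by
  have hsum : ∀ (N : ℕ) (a : G → ℝ), IsPAtomOn p N 0 a → ∀ n : ℕ,
      ∑ m ∈ Finset.Icc (2 ^ N) n,
          (∫⁻ x in I N 0, ENNReal.ofReal |sigmaK a m x| ^ p ∂μG) / (m : ℝ≥0∞) ^ (2 - 2 * p)
        ≤ ∑ m ∈ Finset.Icc (2 ^ N) n, ((m : ℝ≥0∞) ^ (2 - 2 * p))⁻¹ := fun N a ha n => by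
    refine Finset.sum_le_sum fun m _ => ?_
    rw [← one_div]
    exact ENNReal.div_le_div_right
      (setLIntegral_sigmaK_atom_le hp0 (hp.trans (by norm_num)) ha m) _
  rcases hp.lt_or_eq with hlt | rfl
  · refine ⟨∑' m : ℕ, 1 / (m : ℝ) ^ (2 - 2 * p), fun N a ha n _ => ?_⟩
    rw [Nat.floor_eq_zero.2 (by linarith), pow_zero, div_one, one_mul]
    exact (hsum N a ha n).trans (sum_Icc_rpow_inv_le_tsum (by linarith) (by positivity) n)
  · refine ⟨1 / Real.log 2 + 1, fun N a ha n hn => ?_⟩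
    have hlog2 : 0 < Real.log 2 := Real.log_pos one_lt_two
    have hn2 : (2 : ℝ) ≤ n := by
      have : 1 ≤ 2 ^ N := Nat.one_le_two_pow
      exact_mod_cast (by omega : 2 ≤ n)
    have hlog : Real.log 2 ≤ Real.log n := Real.log_le_log two_pos hn2
    have hlogn : 0 < Real.log n := hlog2.trans_le hlog
    have hexp : (2 : ℝ) - 2 * (1 / 2) = 1 := by norm_num
    have hfloor : ⌊(1 / 2 : ℝ) + 1 / 2⌋₊ = 1 := by norm_num
    have h := hsum N a ha n
    rw [hexp] at h
    rw [hfloor, pow_one, hexp]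
    calc _ ≤ 1 / ENNReal.ofReal (Real.log n) * ENNReal.ofReal (1 + Real.log n) := by
          gcongr
          exact h.trans (sum_Icc_inv_le_one_add_log (by positivity) n)
      _ = ENNReal.ofReal (1 / Real.log n + 1) := by
          rw [one_div, ← ENNReal.ofReal_inv_of_pos hlogn,
            ← ENNReal.ofReal_mul (inv_nonneg.2 hlogn.le)]
          congr 1
          field_simp
      _ ≤ ENNReal.ofReal (1 / Real.log 2 + 1) := by gcongr

end WalshKaczmarz
end
end
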